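/- arXiv:2301.07381 — 4 statements merged into one kernel-verified Lean document; each statement's English description precedes it below -/
import Mathlib

section
/- Let b>0 and m>0 with b²<4m. Then there exists a constant C>0 depending only on b and m such that for every ξ∈ℝ and every φ,ψ∈ℂ, the unique solution u:[0,∞)→ℂ of u''(t)+b·u'(t)+(m+ξ²)·u(t)=0 with u(0)=φ and u'(0)=ψ satisfies, for all t≥0: |u(t)| ≤ C(|φ| + |ψ|/(1+|ξ|)), |u'(t)| ≤ C((1+|ξ|)|φ| + |ψ|), and |u''(t)| ≤ C((1+|ξ|)²|φ| + (1+|ξ|)|ψ|). -/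
open Set

/-- Energy estimate for the damped oscillator `u'' + b u' + r² u = 0`, written as a first-order
system for `u` and `v = u'`. -/
theorem damped_oscillator_energy_le {E : Type*} [NormedAddCommGroup E] [InnerProductSpace ℝ E]
    {b r : ℝ} (hb : 0 ≤ b) {u v : ℝ → E}
    (hu : ∀ t ∈ Ici (0 : ℝ), HasDerivWithinAt u (v t) (Ici 0) t)
    (hv : ∀ t ∈ Ici (0 : ℝ), HasDerivWithinAt v (-(b • v t) - r ^ 2 • u t) (Ici 0) t)
    {t : ℝ} (ht : 0 ≤ t) :
    ‖v t‖ ^ 2 + r ^ 2 * ‖u t‖ ^ 2 ≤ ‖v 0‖ ^ 2 + r ^ 2 * ‖u 0‖ ^ 2 := by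
  have hderiv : ∀ x ∈ Ici (0 : ℝ), HasDerivWithinAt (fun y => ‖v y‖ ^ 2 + r ^ 2 * ‖u y‖ ^ 2)
      (-(2 * b * ‖v x‖ ^ 2)) (Ici 0) x := by
    intro x hx
    refine ((hv x hx).norm_sq.add ((hu x hx).norm_sq.const_mul (r ^ 2))).congr_deriv ?_
    rw [inner_sub_right, inner_neg_right, real_inner_smul_right, real_inner_smul_right,
      real_inner_self_eq_norm_sq, real_inner_comm (u x) (v x)]
    ring
  have hanti : AntitoneOn (fun y => ‖v y‖ ^ 2 + r ^ 2 * ‖u y‖ ^ 2) (Ici 0) := by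
    refine antitoneOn_of_hasDerivWithinAt_nonpos (convex_Ici 0)
      (fun x hx => (hderiv x hx).continuousWithinAt)
      (fun x hx => (hderiv x (interior_subset hx)).mono interior_subset) fun x _ => ?_
    exact neg_nonpos.mpr (by positivity)
  exact hanti self_mem_Ici ht ht

theorem le_add_of_sq_add_sq_le {x y p q : ℝ} (hp : 0 ≤ p) (hq : 0 ≤ q)
    (h : x ^ 2 + y ^ 2 ≤ p ^ 2 + q ^ 2) : x ≤ p + q :=
  abs_le_of_sq_le_sq' (by nlinarith [mul_nonneg hp hq, sq_nonneg y]) (add_nonneg hp hq) |>.2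

/-- **Frequency-wise a priori estimates for the homogeneous damped wave ODE.**
For `b > 0`, `m > 0` with `b² < 4m`, there is a constant `C > 0` depending only on `b, m`
such that for every frequency `ξ ∈ ℝ` and all data `φ, ψ ∈ ℂ`, the (unique) solution
`u : [0,∞) → ℂ` of `u'' + b u' + (m + ξ²) u = 0`, `u(0) = φ`, `u'(0) = ψ`, satisfies
`|u(t)| ≤ C(|φ| + |ψ|/(1+|ξ|))`, `|u'(t)| ≤ C((1+|ξ|)|φ| + |ψ|)` and
`|u''(t)| ≤ C((1+|ξ|)²|φ| + (1+|ξ|)|ψ|)` for all `t ≥ 0`. -/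
theorem damped_wave_fourier_apriori (b m : ℝ) (hb : 0 < b) (hm : 0 < m)
    (hbm : b ^ 2 < 4 * m) :
    ∃ C > (0 : ℝ), ∀ ξ : ℝ, ∀ φ ψ : ℂ, ∀ u : ℝ → ℂ,
      ContDiffOn ℝ 2 u (Ici 0) → u 0 = φ → derivWithin u (Ici 0) 0 = ψ →
      (∀ t ∈ Ici (0 : ℝ),
        derivWithin (derivWithin u (Ici 0)) (Ici 0) t + (b : ℂ) * derivWithin u (Ici 0) t +
          ((m + ξ ^ 2 : ℝ) : ℂ) * u t = 0) →
      ∀ t ∈ Ici (0 : ℝ),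
        ‖u t‖ ≤ C * (‖φ‖ + ‖ψ‖ / (1 + |ξ|)) ∧
        ‖derivWithin u (Ici 0) t‖ ≤ C * ((1 + |ξ|) * ‖φ‖ + ‖ψ‖) ∧
        ‖derivWithin (derivWithin u (Ici 0)) (Ici 0) t‖ ≤
          C * ((1 + |ξ|) ^ 2 * ‖φ‖ + (1 + |ξ|) * ‖ψ‖) := by
  obtain ⟨A, hA, hA2⟩ : ∃ A : ℝ, 1 ≤ A ∧ A ^ 2 = m + 1 :=
    ⟨√(m + 1), Real.one_le_sqrt.mpr (by linarith), Real.sq_sqrt (by linarith)⟩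
  obtain ⟨c, hc, hcm, hc1⟩ : ∃ c : ℝ, 0 < c ∧ 2 * c ^ 2 ≤ m ∧ 2 * c ^ 2 ≤ 1 := by
    have hmin : 0 < min m 1 := lt_min hm one_pos
    refine ⟨√(min m 1 / 2), Real.sqrt_pos.mpr (by positivity), ?_, ?_⟩ <;>
      rw [Real.sq_sqrt (by positivity)]
    · linarith [min_le_left m 1]
    · linarith [min_le_right m 1]
  refine ⟨1 / c + (b + A) * A, by positivity, ?_⟩
  rintro ξ φ ψ u hu rfl rfl hode t ht
  set v := derivWithin u (Ici 0)
  obtain ⟨s, hs⟩ : ∃ s, s = 1 + |ξ| := ⟨_, rfl⟩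
  obtain ⟨r, hr, hr2⟩ : ∃ r : ℝ, 0 < r ∧ r ^ 2 = m + ξ ^ 2 :=
    ⟨√(m + ξ ^ 2), Real.sqrt_pos.mpr (by positivity), Real.sq_sqrt (by positivity)⟩
  have hs1 : 1 ≤ s := by linarith [abs_nonneg ξ]
  have hcs : c * s ≤ r := by
    refine abs_le_of_sq_le_sq' ?_ hr.le |>.2
    have : s ^ 2 ≤ 2 * (1 + ξ ^ 2) := by
      rw [hs, ← sq_abs ξ]
      nlinarith [sq_nonneg (1 - |ξ|)]
    rw [mul_pow, hr2]
    nlinarith [sq_nonneg c, sq_nonneg ξ]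
  have hrA : r ≤ A * s := by
    refine abs_le_of_sq_le_sq' ?_ (by positivity) |>.2
    rw [mul_pow, hr2, hA2, hs, ← sq_abs ξ]
    nlinarith [abs_nonneg ξ, mul_nonneg hm.le (abs_nonneg ξ), mul_nonneg hm.le (sq_nonneg |ξ|)]
  have hode' : ∀ x ∈ Ici (0 : ℝ), derivWithin v (Ici 0) x = -(b • v x) - r ^ 2 • u x := by
    intro x hx
    rw [hr2, Complex.real_smul, Complex.real_smul]
    linear_combination hode x hx
  have hdu : ∀ x ∈ Ici (0 : ℝ), HasDerivWithinAt u (v x) (Ici 0) x := fun x hx =>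
    (hu.differentiableOn two_ne_zero x hx).hasDerivWithinAt
  have hdv : ∀ x ∈ Ici (0 : ℝ),
      HasDerivWithinAt v (-(b • v x) - r ^ 2 • u x) (Ici 0) x := fun x hx => by
    rw [← hode' x hx]
    exact ((hu.derivWithin (m := 1) (uniqueDiffOn_Ici 0) (by norm_num)).differentiableOn
      one_ne_zero x hx).hasDerivWithinAt
  have henergy := damped_oscillator_energy_le hb.le hdu hdv ht
  simp only [← mul_pow] at henergy
  have hv_le : ‖v t‖ ≤ ‖v 0‖ + r * ‖u 0‖ :=
    le_add_of_sq_add_sq_le (by positivity) (by positivity) henergy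
  have hu_le : r * ‖u t‖ ≤ ‖v 0‖ + r * ‖u 0‖ :=
    le_add_of_sq_add_sq_le (by positivity) (by positivity) (by rwa [add_comm])
  have hw_le : ‖derivWithin v (Ici 0) t‖ ≤ b * ‖v t‖ + r * (r * ‖u t‖) := by
    rw [hode' t ht]
    refine (norm_sub_le _ _).trans_eq ?_
    rw [norm_neg, norm_smul, norm_smul, Real.norm_of_nonneg hb.le,
      Real.norm_of_nonneg (sq_nonneg r)]
    ring
  rw [← hs]
  have hφ := norm_nonneg (u 0)
  have hψ := norm_nonneg (v 0)
  have hc_inv : 0 < 1 / c := by positivity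
  have hA_le : A ≤ (b + A) * A := by nlinarith
  have hbA_le : b + A ≤ (b + A) * A := by nlinarith
  have hdata : ‖v 0‖ + r * ‖u 0‖ ≤ A * s * ‖u 0‖ + ‖v 0‖ := by
    linarith [mul_le_mul_of_nonneg_right hrA hφ]
  refine ⟨?_, ?_, ?_⟩
  · calc ‖u t‖ ≤ ‖u 0‖ + ‖v 0‖ / r := by
          rw [← mul_le_mul_iff_right₀ hr, mul_add, mul_div_cancel₀ _ hr.ne']
          linarith
      _ ≤ ‖u 0‖ + ‖v 0‖ / (c * s) := by gcongr
      _ = 1 * ‖u 0‖ + 1 / c * (‖v 0‖ / s) := by field_simp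
      _ ≤ (1 / c + (b + A) * A) * ‖u 0‖ + (1 / c + (b + A) * A) * (‖v 0‖ / s) := by
          gcongr <;> linarith
      _ = _ := by ring
  · calc ‖v t‖ ≤ A * (s * ‖u 0‖) + 1 * ‖v 0‖ := by linarith
      _ ≤ (1 / c + (b + A) * A) * (s * ‖u 0‖) + (1 / c + (b + A) * A) * ‖v 0‖ := by
          gcongr <;> linarith
      _ = _ := by ring
  · calc ‖derivWithin v (Ici 0) t‖ ≤ b * ‖v t‖ + r * (r * ‖u t‖) := hw_le
      _ ≤ b * (A * s * ‖u 0‖ + ‖v 0‖) + A * s * (A * s * ‖u 0‖ + ‖v 0‖) := by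
          gcongr <;> linarith
      _ = (b * 1 + A * s) * (A * s * ‖u 0‖ + ‖v 0‖) := by ring
      _ ≤ (b * s + A * s) * (A * s * ‖u 0‖ + ‖v 0‖) := by gcongr
      _ = (b + A) * A * (s ^ 2 * ‖u 0‖) + (b + A) * (s * ‖v 0‖) := by ring
      _ ≤ (1 / c + (b + A) * A) * (s ^ 2 * ‖u 0‖) + (1 / c + (b + A) * A) * (s * ‖v 0‖) := by
          exact add_le_add (mul_le_mul_of_nonneg_right (by linarith) (by positivity))
            (mul_le_mul_of_nonneg_right (by linarith) (by positivity))
      _ = _ := by ring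
end

section
/- Let b>0 and m>0 with b²<4m, let ξ∈ℝ and set c=m+ξ². Let T>0, let g:[0,T]→ℂ be continuous, and let u:[0,T]→ℂ be the unique twice continuously differentiable solution of u''+b·u'+c·u=g with u(0)=u'(0)=0. Then there exists a constant C>0 depending only on b and m (not on ξ, T, g, t) such that for all t∈[0,T]: |u(t)| ≤ (C/(1+|ξ|))·∫₀ᵗ|g(τ)| dτ, |u'(t)| ≤ C·∫₀ᵗ|g(τ)| dτ, and |u''(t)| ≤ |g(t)| + C(1+|ξ|)·∫₀ᵗ|g(τ)| dτ. -/
open Set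

/-- A nonnegative function `E` with `E 0 = 0` and `E' ≤ 2 φ √E` satisfies `√E ≤ ∫ φ`. -/
lemma sqrt_le_integral_of_deriv_le {E E' φ : ℝ → ℝ} {t : ℝ} (ht : 0 ≤ t)
    (hE : ContinuousOn E (Icc 0 t)) (hE' : ∀ x ∈ Ioo 0 t, HasDerivAt E (E' x) x)
    (hE_nonneg : ∀ x, 0 ≤ E x) (hE0 : E 0 = 0) (hφ : ContinuousOn φ (Icc 0 t))
    (hφ_nonneg : ∀ x, 0 ≤ φ x) (hle : ∀ x ∈ Ioo 0 t, E' x ≤ 2 * φ x * √(E x)) :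
    √(E t) ≤ ∫ x in (0 : ℝ)..t, φ x := by
  refine le_of_forall_pos_le_add fun ε hε => ?_
  have hpos : ∀ x, 0 < E x + ε ^ 2 := fun x => by have := hE_nonneg x; positivity
  have key := intervalIntegral.sub_le_integral_of_hasDeriv_right_of_le
    (g := fun x => √(E x + ε ^ 2)) (g' := fun x => E' x / (2 * √(E x + ε ^ 2))) (φ := φ) ht
    (hE.add continuousOn_const).sqrt
    (fun x hx => (((hE' x hx).add_const (ε ^ 2)).sqrt (hpos x).ne').hasDerivWithinAt)
    hφ.integrableOn_Icc
    (fun x hx => by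
      have hs : 0 < √(E x + ε ^ 2) := Real.sqrt_pos.2 (hpos x)
      rw [div_le_iff₀ (by positivity)]
      have hmono : √(E x) ≤ √(E x + ε ^ 2) := Real.sqrt_le_sqrt (by nlinarith)
      nlinarith [hle x hx, mul_le_mul_of_nonneg_left hmono (hφ_nonneg x)])
  simp only [hE0, zero_add, Real.sqrt_sq hε.le] at key
  have hmono : √(E t) ≤ √(E t + ε ^ 2) := Real.sqrt_le_sqrt (by nlinarith)
  linarith

/-- Energy estimate for the damped oscillator `u'' + b u' + c u = g` with zero initial data. -/
lemma sqrt_energy_le_integral_norm {b c T : ℝ} (hb : 0 ≤ b) (hc : 0 ≤ c) {g u v w : ℝ → ℂ}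
    (hg : ContinuousOn g (Icc 0 T))
    (hu : ∀ t ∈ Icc 0 T, HasDerivWithinAt u (v t) (Icc 0 T) t)
    (hv : ∀ t ∈ Icc 0 T, HasDerivWithinAt v (w t) (Icc 0 T) t)
    (hu0 : u 0 = 0) (hv0 : v 0 = 0)
    (heq : ∀ t ∈ Icc 0 T, w t + (b : ℂ) * v t + (c : ℂ) * u t = g t)
    {t : ℝ} (ht : t ∈ Icc 0 T) :
    √(‖v t‖ ^ 2 + c * ‖u t‖ ^ 2) ≤ ∫ τ in (0 : ℝ)..t, ‖g τ‖ := by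
  have hsub : Icc 0 t ⊆ Icc 0 T := Icc_subset_Icc_right ht.2
  have hE : ∀ x ∈ Icc 0 T, HasDerivWithinAt (fun x => ‖v x‖ ^ 2 + c * ‖u x‖ ^ 2)
      (2 * inner ℝ (v x) (w x) + c * (2 * inner ℝ (u x) (v x))) (Icc 0 T) x :=
    fun x hx => (hv x hx).norm_sq.add ((hu x hx).norm_sq.const_mul c)
  refine sqrt_le_integral_of_deriv_le (E := fun x => ‖v x‖ ^ 2 + c * ‖u x‖ ^ 2) ht.1
    (fun x hx => ((hE x (hsub hx)).continuousWithinAt).mono hsub)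
    (fun x hx => (hE x (hsub (Ioo_subset_Icc_self hx))).hasDerivAt
      (Icc_mem_nhds hx.1 (hx.2.trans_le ht.2)))
    (fun x => by positivity) (by simp [hu0, hv0]) (hg.mono hsub).norm
    (fun x => norm_nonneg _) fun x hx => ?_
  have hw : w x = g x - (b • v x + c • u x) := by
    rw [← heq x (hsub (Ioo_subset_Icc_self hx)), Complex.real_smul, Complex.real_smul]; ring
  have hv_le : ‖v x‖ ≤ √(‖v x‖ ^ 2 + c * ‖u x‖ ^ 2) :=
    Real.le_sqrt_of_sq_le (by nlinarith [mul_nonneg hc (sq_nonneg ‖u x‖)])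
  have hinner := real_inner_le_norm (v x) (g x)
  rw [hw, inner_sub_right, inner_add_right, real_inner_smul_right, real_inner_smul_right,
    real_inner_self_eq_norm_sq, real_inner_comm (v x) (u x)]
  nlinarith [mul_le_mul_of_nonneg_left hv_le (norm_nonneg (g x)),
    mul_nonneg hb (sq_nonneg ‖v x‖)]

/-- **Frequency-wise a priori estimates for the non-homogeneous damped wave ODE with zero data.**
For `b > 0`, `m > 0` with `b² < 4m`, there is `C > 0` depending only on `b, m` such that for
every `ξ ∈ ℝ` (with `c = m + ξ²`), every `T > 0`, every continuous `g : [0,T] → ℂ` and every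
twice continuously differentiable solution `u` of `u'' + b u' + c u = g`, `u(0) = u'(0) = 0`,
one has for all `t ∈ [0,T]`:
`|u(t)| ≤ (C/(1+|ξ|)) ∫₀ᵗ |g|`, `|u'(t)| ≤ C ∫₀ᵗ |g|` and
`|u''(t)| ≤ |g(t)| + C (1+|ξ|) ∫₀ᵗ |g|`. -/
theorem duhamel_apriori (b m : ℝ) (hb : 0 < b) (hm : 0 < m) (hbm : b ^ 2 < 4 * m) :
    ∃ C > (0 : ℝ), ∀ ξ : ℝ, ∀ T : ℝ, 0 < T → ∀ g : ℝ → ℂ, ContinuousOn g (Icc 0 T) →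
      ∀ u : ℝ → ℂ, ContDiffOn ℝ 2 u (Icc 0 T) → u 0 = 0 → derivWithin u (Icc 0 T) 0 = 0 →
      (∀ t ∈ Icc (0 : ℝ) T,
        derivWithin (derivWithin u (Icc 0 T)) (Icc 0 T) t + (b : ℂ) * derivWithin u (Icc 0 T) t +
          ((m + ξ ^ 2 : ℝ) : ℂ) * u t = g t) →
      ∀ t ∈ Icc (0 : ℝ) T,
        ‖u t‖ ≤ (C / (1 + |ξ|)) * (∫ τ in (0 : ℝ)..t, ‖g τ‖) ∧
        ‖derivWithin u (Icc 0 T) t‖ ≤ C * (∫ τ in (0 : ℝ)..t, ‖g τ‖) ∧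
        ‖derivWithin (derivWithin u (Icc 0 T)) (Icc 0 T) t‖ ≤
          ‖g t‖ + C * (1 + |ξ|) * (∫ τ in (0 : ℝ)..t, ‖g τ‖) := by
  have hsm : 0 < √m := Real.sqrt_pos.2 hm
  refine ⟨1 + 1 / √m + b + √m, by positivity, ?_⟩
  intro ξ T hT g hg u hu hu0 hv0 heq t ht
  set v := derivWithin u (Icc 0 T)
  set w := derivWithin v (Icc 0 T)
  have huniq := uniqueDiffOn_Icc hT
  have hv : ContDiffOn ℝ 1 v (Icc 0 T) := hu.derivWithin huniq (by norm_num)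
  have hc : 0 ≤ m + ξ ^ 2 := by positivity
  have henergy := sqrt_energy_le_integral_norm hb.le hc hg
    (fun x hx => (hu.differentiableOn (by norm_num) x hx).hasDerivWithinAt)
    (fun x hx => (hv.differentiableOn (by norm_num) x hx).hasDerivWithinAt)
    hu0 hv0 heq ht
  set I := ∫ τ in (0 : ℝ)..t, ‖g τ‖
  set s := √(m + ξ ^ 2)
  have hv_le : ‖v t‖ ≤ I := (Real.le_sqrt_of_sq_le (by
    nlinarith [mul_nonneg hc (sq_nonneg ‖u t‖)])).trans henergy
  have hs_sq : s ^ 2 = m + ξ ^ 2 := Real.sq_sqrt hc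
  have hs_nonneg : 0 ≤ s := Real.sqrt_nonneg _
  have hsu_le : s * ‖u t‖ ≤ I := (Real.le_sqrt_of_sq_le (by
    rw [mul_pow, hs_sq]; nlinarith [sq_nonneg ‖v t‖])).trans henergy
  have hI : 0 ≤ I := (norm_nonneg _).trans hv_le
  have hm_le : √m ≤ s := Real.sqrt_le_sqrt (by nlinarith [sq_nonneg ξ])
  have hξ_le : |ξ| ≤ s := Real.abs_le_sqrt (by linarith)
  have hs_le : s ≤ √m + |ξ| := by
    refine Real.sqrt_le_iff.2 ⟨by positivity, ?_⟩
    nlinarith [Real.sq_sqrt hm.le, sq_abs ξ, mul_nonneg hsm.le (abs_nonneg ξ)]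
  have hξ : 0 ≤ |ξ| := abs_nonneg ξ
  have hinv : 0 < 1 / √m := by positivity
  refine ⟨?_, ?_, ?_⟩
  · have hone : 1 ≤ 1 / √m * s := by
      rw [one_div_mul_eq_div, one_le_div hsm]; exact hm_le
    rw [div_mul_eq_mul_div, le_div_iff₀ (by positivity)]
    calc ‖u t‖ * (1 + |ξ|) ≤ ‖u t‖ * ((1 + 1 / √m) * s) := by gcongr; linarith
      _ = (1 + 1 / √m) * (s * ‖u t‖) := by ring
      _ ≤ (1 + 1 / √m) * I := by gcongr
      _ ≤ (1 + 1 / √m + b + √m) * I :=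
          mul_le_mul_of_nonneg_right (by linarith) hI
  · exact hv_le.trans (le_mul_of_one_le_left hI (by linarith))
  · have hw : w t = g t - (b : ℂ) * v t - ((m + ξ ^ 2 : ℝ) : ℂ) * u t := by
      rw [← heq t ht]; ring
    calc ‖w t‖ ≤ ‖g t‖ + ‖(b : ℂ) * v t‖ + ‖((m + ξ ^ 2 : ℝ) : ℂ) * u t‖ := by
          rw [hw]; exact (norm_sub_le _ _).trans (by gcongr; exact norm_sub_le _ _)
      _ = ‖g t‖ + (b * ‖v t‖ + s * (s * ‖u t‖)) := by
          rw [norm_mul, norm_mul, Complex.norm_of_nonneg hb.le, Complex.norm_of_nonneg hc,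
            ← hs_sq]
          ring
      _ ≤ ‖g t‖ + (b * I + (√m + |ξ|) * I) := by gcongr
      _ = ‖g t‖ + (b + √m + |ξ|) * I := by ring
      _ ≤ ‖g t‖ + (1 + 1 / √m + b + √m) * (1 + |ξ|) * I := by
          gcongr
          nlinarith [mul_nonneg hinv.le hξ, mul_nonneg hb.le hξ, mul_nonneg hsm.le hξ]
end

section
/- For every z∈ℂ, cos_{q²}(z)→cos(z) as q→1⁻, and the convergence is uniform on compact subsets of ℂ: for every compact set K⊆ℂ and every ε>0 there exists δ∈(0,1) such that for all q with 1−δ<q<1 one has sup_{z∈K}|cos_{q²}(z)−cos(z)|<ε. -/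
open Filter Set

/-- The q-number `[n]_q = (1 - qⁿ)/(1 - q)`. -/
noncomputable def qNum (q : ℝ) (n : ℕ) : ℝ := (1 - q ^ n) / (1 - q)

/-- The q-factorial `[n]_q! = [1]_q [2]_q ⋯ [n]_q`, with `[0]_q! = 1`. -/
noncomputable def qFact (q : ℝ) : ℕ → ℝ
  | 0 => 1
  | n + 1 => qFact q n * qNum q (n + 1)

/-- The q²-cosine `cos_{q²}(z) = Σₖ (-1)ᵏ q^{k(k+1)} z^{2k}/[2k]_q!`. -/
noncomputable def qCos (q : ℝ) (z : ℂ) : ℂ :=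
  ∑' k : ℕ, ((-1 : ℂ) ^ k * (q : ℂ) ^ (k * (k + 1)) * z ^ (2 * k)) / ((qFact q (2 * k) : ℝ) : ℂ)

open Topology

lemma qNum_eq_geom_sum {q : ℝ} (hq : q < 1) (n : ℕ) :
    qNum q n = ∑ i ∈ Finset.range n, q ^ i := by
  rw [geom_sum_eq hq.ne, qNum, ← neg_sub, ← neg_sub q 1, neg_div_neg_eq]

lemma qNum_add_two {q : ℝ} (hq : q < 1) (n : ℕ) :
    qNum q (n + 2) = 1 + q ^ (n + 1) + q * qNum q n := by
  have h : 1 - q ≠ 0 := by linarith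
  simp only [qNum]
  field_simp
  ring

/-- A form of the AM-GM inequality for `1, q, …, q ^ (n - 1)`. -/
lemma nat_mul_pow_le_qNum {q : ℝ} (hq₀ : 0 < q) (hq : q < 1) :
    ∀ n m : ℕ, n ≤ 2 * m + 1 → n * q ^ m ≤ qNum q n
  | 0, m, _ => by simp [qNum]
  | 1, m, _ => by
    have h : 1 - q ≠ 0 := by linarith
    simpa [qNum, h] using pow_le_one₀ hq₀.le hq.le
  | n + 2, 0, h => by omega
  | n + 2, m + 1, h => by
    have ih := mul_le_mul_of_nonneg_left
      (nat_mul_pow_le_qNum hq₀ hq n m (by omega)) hq₀.le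
    have hpow : q ^ (2 * (m + 1)) ≤ q ^ (n + 1) :=
      pow_le_pow_of_le_one hq₀.le hq.le (by omega)
    rw [qNum_add_two hq]
    push_cast
    have hsq := sq_nonneg (1 - q ^ (m + 1))
    have h₁ : q ^ (2 * (m + 1)) = (q ^ (m + 1)) ^ 2 := by ring
    have h₂ : q * (n * q ^ m) = n * q ^ (m + 1) := by ring
    nlinarith

lemma qFact_pos {q : ℝ} (hq₀ : 0 < q) (hq : q < 1) (n : ℕ) : 0 < qFact q n := by
  induction n with
  | zero => simp [qFact]
  | succ n ih =>
    exact mul_pos ih (div_pos (sub_pos.2 (pow_lt_one₀ hq₀.le hq n.succ_ne_zero)) (sub_pos.2 hq))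

lemma factorial_mul_pow_le_qFact {q : ℝ} (hq₀ : 0 < q) (hq : q < 1) (k : ℕ) :
    (2 * k).factorial * q ^ (k * (k + 1)) ≤ qFact q (2 * k) := by
  induction k with
  | zero => simp [qFact]
  | succ k ih =>
    have h₁ := nat_mul_pow_le_qNum hq₀ hq (2 * k + 1) (k + 1) (by omega)
    have h₂ := nat_mul_pow_le_qNum hq₀ hq (2 * k + 2) (k + 1) (by omega)
    calc ((2 * (k + 1)).factorial : ℝ) * q ^ ((k + 1) * (k + 1 + 1))
        = (2 * k).factorial * q ^ (k * (k + 1)) * ((2 * k + 1 : ℕ) * q ^ (k + 1)) *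
            ((2 * k + 2 : ℕ) * q ^ (k + 1)) := by
          rw [show 2 * (k + 1) = 2 * k + 1 + 1 by ring, Nat.factorial_succ, Nat.factorial_succ]
          push_cast
          ring
      _ ≤ qFact q (2 * k) * qNum q (2 * k + 1) * qNum q (2 * k + 2) := by
          have := (qFact_pos hq₀ hq (2 * k)).le
          have h₃ : 0 ≤ qNum q (2 * k + 1) := le_trans (by positivity) h₁
          gcongr

/-- The absolute value of the coefficient of `z ^ (2 * k)` in `qCos q z`. -/
noncomputable def qCosCoeff (q : ℝ) (k : ℕ) : ℝ := q ^ (k * (k + 1)) / qFact q (2 * k)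

lemma qCosCoeff_nonneg {q : ℝ} (hq₀ : 0 < q) (hq : q < 1) (k : ℕ) : 0 ≤ qCosCoeff q k :=
  div_nonneg (by positivity) (qFact_pos hq₀ hq _).le

lemma qCosCoeff_le {q : ℝ} (hq₀ : 0 < q) (hq : q < 1) (k : ℕ) :
    qCosCoeff q k ≤ 1 / (2 * k).factorial := by
  rw [qCosCoeff, div_le_div_iff₀ (qFact_pos hq₀ hq _) (by positivity), one_mul, mul_comm]
  exact factorial_mul_pow_le_qFact hq₀ hq k

lemma tendsto_qNum (n : ℕ) : Tendsto (fun q => qNum q n) (𝓝[<] 1) (𝓝 n) := by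
  have h : Tendsto (fun q : ℝ => ∑ i ∈ Finset.range n, q ^ i) (𝓝[<] 1) (𝓝 n) := by
    have hc : Continuous fun q : ℝ => ∑ i ∈ Finset.range n, q ^ i := by fun_prop
    simpa using (hc.tendsto 1).mono_left nhdsWithin_le_nhds
  refine h.congr' ?_
  filter_upwards [self_mem_nhdsWithin] with q hq using (qNum_eq_geom_sum hq n).symm

lemma tendsto_qFact (n : ℕ) : Tendsto (fun q => qFact q n) (𝓝[<] 1) (𝓝 n.factorial) := by
  induction n with
  | zero => simp [qFact]
  | succ n ih =>
    rw [Nat.factorial_succ, mul_comm, Nat.cast_mul]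
    exact ih.mul (tendsto_qNum (n + 1))

lemma tendsto_qCosCoeff (k : ℕ) :
    Tendsto (fun q => qCosCoeff q k) (𝓝[<] 1) (𝓝 (1 / (2 * k).factorial)) := by
  refine Tendsto.div ?_ (tendsto_qFact _) (by positivity)
  simpa using ((continuous_pow (M := ℝ) (k * (k + 1))).tendsto 1).mono_left nhdsWithin_le_nhds

lemma summable_pow_div_factorial_two_mul (R : ℝ) :
    Summable fun k : ℕ => R ^ (2 * k) / (2 * k).factorial :=
  (Real.summable_pow_div_factorial R).comp_injective
    (i := fun k : ℕ => 2 * k) (mul_right_injective₀ two_ne_zero)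

lemma abs_qCosCoeff_sub_le {q : ℝ} (hq₀ : 0 < q) (hq : q < 1) (k : ℕ) :
    |qCosCoeff q k - 1 / (2 * k).factorial| ≤ 1 / (2 * k).factorial := by
  rw [abs_le]
  constructor <;> linarith [qCosCoeff_nonneg hq₀ hq k, qCosCoeff_le hq₀ hq k,
    show (0 : ℝ) ≤ 1 / (2 * k).factorial by positivity]

lemma pow_mul_abs_qCosCoeff_sub_le {q R : ℝ} (hq₀ : 0 < q) (hq : q < 1) (k : ℕ) :
    R ^ (2 * k) * |qCosCoeff q k - 1 / (2 * k).factorial| ≤ R ^ (2 * k) / (2 * k).factorial := by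
  rw [div_eq_mul_one_div (R ^ _)]
  exact mul_le_mul_of_nonneg_left (abs_qCosCoeff_sub_le hq₀ hq k) ((even_two_mul k).pow_nonneg R)

lemma tendsto_tsum_pow_mul_abs_qCosCoeff_sub (R : ℝ) :
    Tendsto (fun q => ∑' k : ℕ, R ^ (2 * k) * |qCosCoeff q k - 1 / (2 * k).factorial|)
      (𝓝[<] 1) (𝓝 0) := by
  rw [← tsum_zero (α := ℝ) (β := ℕ)]
  refine tendsto_tsum_of_dominated_convergence (summable_pow_div_factorial_two_mul R) ?_ ?_
  · intro k
    simpa using ((tendsto_qCosCoeff k).sub_const (1 / (2 * k).factorial : ℝ)).abs.const_mul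
      (R ^ (2 * k))
  · filter_upwards [Ioo_mem_nhdsLT zero_lt_one] with q hq k
    rw [Real.norm_of_nonneg (mul_nonneg ((even_two_mul k).pow_nonneg R) (abs_nonneg _))]
    exact pow_mul_abs_qCosCoeff_sub_le hq.1 hq.2 k

lemma qCos_eq_tsum (q : ℝ) (z : ℂ) :
    qCos q z = ∑' k : ℕ, (-1 : ℂ) ^ k * z ^ (2 * k) * (qCosCoeff q k : ℂ) := by
  refine tsum_congr fun k => ?_
  simp only [qCosCoeff]
  push_cast
  ring

lemma summable_qCos {q : ℝ} (hq₀ : 0 < q) (hq : q < 1) (z : ℂ) :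
    Summable fun k : ℕ => (-1 : ℂ) ^ k * z ^ (2 * k) * (qCosCoeff q k : ℂ) := by
  refine .of_norm_bounded (summable_pow_div_factorial_two_mul ‖z‖) fun k => ?_
  simp only [norm_mul, norm_pow, norm_neg, norm_one, one_pow, one_mul, Complex.norm_real,
    Real.norm_of_nonneg (qCosCoeff_nonneg hq₀ hq k)]
  rw [div_eq_mul_one_div]
  exact mul_le_mul_of_nonneg_left (qCosCoeff_le hq₀ hq k) (by positivity)

lemma norm_qCos_sub_cos_le {q R : ℝ} (hq₀ : 0 < q) (hq : q < 1) {z : ℂ} (hz : ‖z‖ ≤ R) :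
    ‖qCos q z - Complex.cos z‖ ≤
      ∑' k : ℕ, R ^ (2 * k) * |qCosCoeff q k - 1 / (2 * k).factorial| := by
  have hsum : Summable fun k : ℕ => R ^ (2 * k) * |qCosCoeff q k - 1 / (2 * k).factorial| :=
    .of_nonneg_of_le (fun k => mul_nonneg ((even_two_mul k).pow_nonneg R) (abs_nonneg _))
      (pow_mul_abs_qCosCoeff_sub_le hq₀ hq) (summable_pow_div_factorial_two_mul R)
  have hcos := Complex.hasSum_cos z
  rw [qCos_eq_tsum, ← hcos.tsum_eq, ← (summable_qCos hq₀ hq z).tsum_sub hcos.summable]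
  refine tsum_of_norm_bounded hsum.hasSum fun k => ?_
  have hterm : (-1 : ℂ) ^ k * z ^ (2 * k) * (qCosCoeff q k : ℂ) -
      (-1) ^ k * z ^ (2 * k) / (2 * k).factorial =
      (-1) ^ k * z ^ (2 * k) * ((qCosCoeff q k - 1 / (2 * k).factorial : ℝ) : ℂ) := by
    push_cast
    ring
  rw [hterm]
  simp only [norm_mul, norm_pow, norm_neg, norm_one, one_pow, one_mul, Complex.norm_real,
    Real.norm_eq_abs]
  gcongr

lemma exists_norm_qCos_sub_cos_lt {K : Set ℂ} (hK : IsCompact K) {ε : ℝ} (hε : 0 < ε) :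
    ∃ δ ∈ Ioo (0 : ℝ) 1,
      ∀ q : ℝ, 1 - δ < q → q < 1 → ∀ z ∈ K, ‖qCos q z - Complex.cos z‖ < ε := by
  obtain ⟨R, hR⟩ := hK.isBounded.exists_norm_le
  have hev := (tendsto_tsum_pow_mul_abs_qCosCoeff_sub R).eventually_lt_const hε
  obtain ⟨l, hl, hlt⟩ := (mem_nhdsLT_iff_exists_mem_Ico_Ioo_subset (zero_lt_one' ℝ)).1 hev
  refine ⟨(1 - l) / 2, ⟨by linarith [hl.2], by linarith [hl.1]⟩, fun q hq hq₁ z hz => ?_⟩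
  exact (norm_qCos_sub_cos_le (by linarith [hl.1, hl.2]) hq₁ (hR z hz)).trans_lt
    (hlt ⟨by linarith [hl.2], hq₁⟩)

/-- **`cos_{q²} → cos` as `q → 1⁻`, uniformly on compact subsets of `ℂ`:**
for every `z ∈ ℂ`, `cos_{q²}(z) → cos z` as `q → 1⁻`, and for every compact `K ⊆ ℂ` and
`ε > 0` there is `δ ∈ (0,1)` such that `sup_{z ∈ K} |cos_{q²}(z) - cos z| < ε` whenever
`1 - δ < q < 1`. -/
theorem qCos_tendsto_cos :
    (∀ z : ℂ, Tendsto (fun q : ℝ => qCos q z) (nhdsWithin 1 (Ioo 0 1))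
      (nhds (Complex.cos z))) ∧
    ∀ K : Set ℂ, IsCompact K → ∀ ε > (0 : ℝ), ∃ δ ∈ Ioo (0 : ℝ) 1,
      ∀ q : ℝ, 1 - δ < q → q < 1 → ∀ z ∈ K, ‖qCos q z - Complex.cos z‖ < ε := by
  refine ⟨fun z => Metric.tendsto_nhds.2 fun ε hε => ?_,
    fun K hK ε hε => exists_norm_qCos_sub_cos_lt hK hε⟩
  obtain ⟨δ, hδ, h⟩ := exists_norm_qCos_sub_cos_lt (isCompact_singleton (x := z)) hε
  filter_upwards [self_mem_nhdsWithin,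
    mem_nhdsWithin_of_mem_nhds (Ioi_mem_nhds (show 1 - δ < 1 by linarith [hδ.1]))] with q hq hqδ
  rw [dist_eq_norm]
  exact h q hqδ hq.2 z rfl
end

section
/- Let f:ℝ→ℂ, let x∈ℝ with x≠0, and suppose f is differentiable at both x and −x. Then Rubin's q-derivative 𝒟_q f(x)=[f(q⁻¹x)+f(−q⁻¹x)−f(qx)+f(−qx)−2f(−x)]/(2x(1−q)) converges to f'(x) as q→1⁻, i.e. lim_{q→1⁻} 𝒟_q f(x) = f'(x). -/
open Filter Set

/-- Rubin's q²-difference operator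
`𝒟_q f(x) = [f(q⁻¹x) + f(-q⁻¹x) - f(qx) + f(-qx) - 2f(-x)]/(2x(1-q))`. -/
noncomputable def rubinD (q : ℝ) (f : ℝ → ℂ) (x : ℝ) : ℂ :=
  (f (q⁻¹ * x) + f (-(q⁻¹ * x)) - f (q * x) + f (-(q * x)) - 2 * f (-x)) /
    (((2 * x * (1 - q) : ℝ)) : ℂ)

/-- **Rubin's q-derivative converges to the ordinary derivative as `q → 1⁻`:**
if `f : ℝ → ℂ` is differentiable at `x ≠ 0` and at `-x`, then `𝒟_q f(x) → f'(x)`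
as `q → 1⁻`. -/
theorem rubin_qderiv_tendsto_deriv (f : ℝ → ℂ) (x : ℝ) (hx : x ≠ 0)
    (hfx : DifferentiableAt ℝ f x) (hfx' : DifferentiableAt ℝ f (-x)) :
    Tendsto (fun q : ℝ => rubinD q f x) (nhdsWithin 1 (Ioo 0 1)) (nhds (deriv f x)) := by
  have hinv : HasDerivAt (fun q : ℝ => q⁻¹ * x) (-x) 1 := by
    simpa using (hasDerivAt_inv (one_ne_zero (α := ℝ))).mul_const x
  have hmul : HasDerivAt (fun q : ℝ => q * x) x 1 := by
    simpa using (hasDerivAt_id (1 : ℝ)).mul_const x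
  have hpos : HasDerivAt f (deriv f x) x := hfx.hasDerivAt
  have hneg : HasDerivAt f (deriv f (-x)) (-x) := hfx'.hasDerivAt
  have h₁ := hpos.scomp_of_eq 1 hinv (by simp)
  have h₂ := hneg.scomp_of_eq 1 hinv.fun_neg (by simp)
  have h₃ := hpos.scomp_of_eq 1 hmul (by simp)
  have h₄ := hneg.scomp_of_eq 1 hmul.fun_neg (by simp)
  have hnum := (((h₁.add h₂).sub h₃).add h₄).sub_const (2 * f (-x))
  have hslope := (hasDerivAt_iff_tendsto_slope.mp hnum).mono_left
    (nhdsWithin_mono 1 fun q (hq : q ∈ Ioo (0 : ℝ) 1) => hq.2.ne)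
  have hxC : (x : ℂ) ≠ 0 := Complex.ofReal_ne_zero.mpr hx
  have hlim := hslope.mul_const (-(2 * (x : ℂ))⁻¹)
  refine (hlim.congr' ?_).trans (le_of_eq (congrArg nhds ?_))
  · filter_upwards [self_mem_nhdsWithin] with q hq
    have hq₁ : (1 : ℂ) - q ≠ 0 := by
      exact_mod_cast (sub_pos.mpr hq.2).ne'
    have hq₂ : (q : ℂ) - 1 ≠ 0 := by
      exact_mod_cast (sub_neg.mpr hq.2).ne
    simp only [rubinD, slope_def_module, Complex.real_smul, Function.comp_apply, Pi.add_apply,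
      Pi.sub_apply, inv_one, one_mul]
    push_cast
    field_simp
    ring
  · simp only [Complex.real_smul]
    push_cast
    field_simp
    ring
end
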